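/- Let Ω̄ ⊂ ℝ^{1+d} be compact, let A_j : Ω̄ → End(ℂ^N), j = 1,…,d, be smooth Hermitian-matrix-valued, and set A(t,x,ξ) = ∑_j A_j(t,x) ξ_j and σ_{L₀}(t,x,τ,ξ) = i(τ I + A(t,x,ξ)), which extends to a polynomial in (τ,ξ) ∈ ℂ × ℂ^d. Suppose λ_l : Ω̄ × (ℝ^d \ {0}) → ℝ and π_l : Ω̄ × (ℝ^d \ {0}) → End(ℂ^N) are smooth with ∑_l π_l = I, π_l π_{l'} = δ_{ll'} π_l and A π_l = λ_l π_l pointwise. Let φ = 𝜑 + iχ ∈ C^∞(Ω̄; ℂ) with χ ≥ 0, d_x𝜑(t,x) ≠ 0 on Ω̄. Then for every integer n ≥ 1 there is a constant C such that for all (t,x) ∈ Ω̄ with |d_xχ(t,x)| ≤ 1: ‖ −i σ_{L₀}(t,x, ∂_tφ(t,x), d_xφ(t,x)) − ∑_l (∂_tφ(t,x) + λ̃_l⁽ⁿ⁾(t,x, d_xφ(t,x))) π̃_l⁽ⁿ⁾(t,x, d_xφ(t,x)) ‖ ≤ C |d_xχ(t,x)|^{n+1}, where the extensions are evaluated at the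 complex vector d_xφ = d_x𝜑 + i d_xχ. -/

import Mathlib

attribute [local instance] Matrix.normedAddCommGroup Matrix.normedSpace

/-- Partial derivative in the `i`-th coordinate direction. -/
noncomputable def pd {E : Type*} [NormedAddCommGroup E] [NormedSpace ℝ E] {m : ℕ}
    (i : Fin m) (f : EuclideanSpace ℝ (Fin m) → E) : EuclideanSpace ℝ (Fin m) → E :=
  fun x => fderiv ℝ f x (EuclideanSpace.single i 1)

/-- Iterated partial derivative `∂^α` associated with the multi-index `α`. -/
noncomputable def mpd {E : Type*} [NormedAddCommGroup E] [NormedSpace ℝ E] {m : ℕ}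
    (α : Fin m → ℕ) (f : EuclideanSpace ℝ (Fin m) → E) : EuclideanSpace ℝ (Fin m) → E :=
  (List.finRange m).foldr (fun i g => (pd i)^[α i] g) f

/-- The `n`-th order complex extension
`f̃⁽ⁿ⁾(ξ+iη) = ∑_{|α| ≤ n} (i^{|α|}/α!) ∂_ξ^α f(ξ) η^α`. -/
noncomputable def cext {E : Type*} [NormedAddCommGroup E] [NormedSpace ℂ E] {m : ℕ}
    (n : ℕ) (f : EuclideanSpace ℝ (Fin m) → E) (ξ η : EuclideanSpace ℝ (Fin m)) : E :=
  ∑ α ∈ Finset.univ.filter (fun α : Fin m → Fin (n + 1) => ∑ i, (α i : ℕ) ≤ n),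
    ((Complex.I ^ (∑ i, (α i : ℕ)) * ∏ i, (η i : ℂ) ^ (α i : ℕ)) /
        (∏ i, ((α i : ℕ).factorial : ℂ))) • mpd (fun i => (α i : ℕ)) f ξ

/-- The real part of the spatial gradient of `φ`. -/
noncomputable def dxRe {d : ℕ} (φ : ℝ × EuclideanSpace ℝ (Fin d) → ℂ)
    (p : ℝ × EuclideanSpace ℝ (Fin d)) : EuclideanSpace ℝ (Fin d) :=
  (EuclideanSpace.equiv (Fin d) ℝ).symm fun i =>
    (fderiv ℝ φ p (0, EuclideanSpace.single i 1)).re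

/-- The imaginary part of the spatial gradient of `φ`. -/
noncomputable def dxIm {d : ℕ} (φ : ℝ × EuclideanSpace ℝ (Fin d) → ℂ)
    (p : ℝ × EuclideanSpace ℝ (Fin d)) : EuclideanSpace ℝ (Fin d) :=
  (EuclideanSpace.equiv (Fin d) ℝ).symm fun i =>
    (fderiv ℝ φ p (0, EuclideanSpace.single i 1)).im

/-- The time derivative of `φ`. -/
noncomputable def dtP {d : ℕ} (φ : ℝ × EuclideanSpace ℝ (Fin d) → ℂ)
    (p : ℝ × EuclideanSpace ℝ (Fin d)) : ℂ :=
  fderiv ℝ φ p (1, 0)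


section helpers

open Set Filter Topology
open scoped ContDiff

variable {E : Type*} [NormedAddCommGroup E] [NormedSpace ℝ E]
  {E' : Type*} [NormedAddCommGroup E'] [NormedSpace ℝ E'] {m : ℕ}

/-- iterated partial derivative along a list of coordinates -/
noncomputable def mpdL (L : List (Fin m)) (α : Fin m → ℕ)
    (f : EuclideanSpace ℝ (Fin m) → E) : EuclideanSpace ℝ (Fin m) → E :=
  L.foldr (fun i g => (pd i)^[α i] g) f

theorem mpd_eq_mpdL (α : Fin m → ℕ) (f : EuclideanSpace ℝ (Fin m) → E) :
    mpd α f = mpdL (List.finRange m) α f := rfl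

theorem mpdL_nil (α : Fin m → ℕ) (f : EuclideanSpace ℝ (Fin m) → E) :
    mpdL [] α f = f := rfl

theorem mpdL_cons (j : Fin m) (L : List (Fin m)) (α : Fin m → ℕ)
    (f : EuclideanSpace ℝ (Fin m) → E) :
    mpdL (j :: L) α f = (pd j)^[α j] (mpdL L α f) := rfl

variable {U : Set (EuclideanSpace ℝ (Fin m))}

theorem pd_congr (hU : IsOpen U) (i : Fin m) {f g : EuclideanSpace ℝ (Fin m) → E}
    (h : EqOn f g U) : EqOn (pd i f) (pd i g) U := by
  intro x hx
  have : f =ᶠ[𝓝 x] g := h.eventuallyEq_of_mem (hU.mem_nhds hx)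
  simp only [pd, this.fderiv_eq]

theorem pd_iter_congr (hU : IsOpen U) (i : Fin m) (k : ℕ) {f g : EuclideanSpace ℝ (Fin m) → E}
    (h : EqOn f g U) : EqOn ((pd i)^[k] f) ((pd i)^[k] g) U := by
  induction k generalizing f g with
  | zero => exact h
  | succ k ih => exact ih (pd_congr hU i h)

theorem mpdL_congr (hU : IsOpen U) (L : List (Fin m)) (α : Fin m → ℕ)
    {f g : EuclideanSpace ℝ (Fin m) → E}
    (h : EqOn f g U) : EqOn (mpdL L α f) (mpdL L α g) U := by
  induction L with
  | nil => exact h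
  | cons j L ih => exact pd_iter_congr hU j _ ih

theorem pd_smooth (hU : IsOpen U) (i : Fin m) {f : EuclideanSpace ℝ (Fin m) → E}
    (hf : ContDiffOn ℝ ∞ f U) : ContDiffOn ℝ ∞ (pd i f) U :=
  (hf.fderiv_of_isOpen hU (by simp)).clm_apply contDiffOn_const

theorem pd_iter_smooth (hU : IsOpen U) (i : Fin m) (k : ℕ) {f : EuclideanSpace ℝ (Fin m) → E}
    (hf : ContDiffOn ℝ ∞ f U) : ContDiffOn ℝ ∞ ((pd i)^[k] f) U := by
  induction k generalizing f with
  | zero => exact hf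
  | succ k ih => exact ih (pd_smooth hU i hf)

theorem mpdL_smooth (hU : IsOpen U) (L : List (Fin m)) (α : Fin m → ℕ)
    {f : EuclideanSpace ℝ (Fin m) → E}
    (hf : ContDiffOn ℝ ∞ f U) : ContDiffOn ℝ ∞ (mpdL L α f) U := by
  induction L with
  | nil => exact hf
  | cons j L ih => exact pd_iter_smooth hU j _ ih

theorem smooth_diffAt (hU : IsOpen U) {f : EuclideanSpace ℝ (Fin m) → E}
    (hf : ContDiffOn ℝ ∞ f U) {x} (hx : x ∈ U) : DifferentiableAt ℝ f x :=
  (hf.contDiffAt (hU.mem_nhds hx)).differentiableAt (by simp)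

theorem pd_comm (hU : IsOpen U) (i j : Fin m) {f : EuclideanSpace ℝ (Fin m) → E}
    (hf : ContDiffOn ℝ ∞ f U) : EqOn (pd i (pd j f)) (pd j (pd i f)) U := by
  intro x hx
  have hs : IsSymmSndFDerivAt ℝ f x := 
    (hf.contDiffAt (hU.mem_nhds hx)).isSymmSndFDerivAt
      (by rw [minSmoothness_of_isRCLikeNormedField]; exact WithTop.coe_le_coe.2 le_top)
  have hd : DifferentiableAt ℝ (fderiv ℝ f) x :=
    ((hf.fderiv_of_isOpen hU (m := ∞) (by simp)).contDiffAt (hU.mem_nhds hx)).differentiableAt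
      (by simp)
  have key : ∀ a b : Fin m, pd a (pd b f) x =
      fderiv ℝ (fderiv ℝ f) x (EuclideanSpace.single a 1) (EuclideanSpace.single b 1) := by
    intro a b
    unfold pd
    rw [fderiv_clm_apply hd (differentiableAt_const _)]
    simp
  rw [key, key]
  exact hs _ _

theorem pd_iter_comm (hU : IsOpen U) (i j : Fin m) (k : ℕ) {f : EuclideanSpace ℝ (Fin m) → E}
    (hf : ContDiffOn ℝ ∞ f U) : EqOn (pd i ((pd j)^[k] f)) ((pd j)^[k] (pd i f)) U := by
  induction k generalizing f with
  | zero => exact fun x _ => rfl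
  | succ k ih =>
    refine (ih (pd_smooth hU j hf)).trans ?_
    exact pd_iter_congr hU j k (pd_comm hU i j hf)

theorem pd_mpdL_comm (hU : IsOpen U) (i : Fin m) (L : List (Fin m)) (α : Fin m → ℕ)
    {f : EuclideanSpace ℝ (Fin m) → E}
    (hf : ContDiffOn ℝ ∞ f U) : EqOn (pd i (mpdL L α f)) (mpdL L α (pd i f)) U := by
  induction L with
  | nil => exact fun x _ => rfl
  | cons j L ih =>
    refine (pd_iter_comm hU i j _ (mpdL_smooth hU L α hf)).trans ?_
    exact pd_iter_congr hU j _ ih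

theorem mpdL_succ (hU : IsOpen U) (i : Fin m) (L : List (Fin m)) (hL : L.Nodup) (α : Fin m → ℕ)
    {f : EuclideanSpace ℝ (Fin m) → E}
    (hf : ContDiffOn ℝ ∞ f U) :
    EqOn (mpdL L (α + Pi.single i 1) f) (mpdL L α (if i ∈ L then pd i f else f)) U := by
  induction L with
  | nil => intro x _; simp [mpdL_nil]
  | cons j L ih =>
    have hL' := List.nodup_cons.1 hL
    specialize ih hL'.2
    rw [mpdL_cons, mpdL_cons]
    by_cases hij : i = j
    · subst hij
      simp only [hL'.1, if_false] at ih
      simp only [List.mem_cons, true_or, if_true, Pi.add_apply, Pi.single_eq_same,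
        Function.iterate_succ_apply]
      apply pd_iter_congr hU
      exact (pd_congr hU i ih).trans (pd_mpdL_comm hU i L α hf)
    · have : (α + Pi.single i 1 : Fin m → ℕ) j = α j := by simp [Ne.symm hij]
      rw [this]
      simp only [List.mem_cons, hij, false_or]
      exact pd_iter_congr hU _ _ ih

theorem mpd_succ (hU : IsOpen U) (i : Fin m) (α : Fin m → ℕ)
    {f : EuclideanSpace ℝ (Fin m) → E} (hf : ContDiffOn ℝ ∞ f U) :
    EqOn (mpd (α + Pi.single i 1) f) (mpd α (pd i f)) U := by
  have := mpdL_succ hU i _ (List.nodup_finRange m) α hf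
  simpa [mpd_eq_mpdL] using this

theorem mpd_zero (f : EuclideanSpace ℝ (Fin m) → E) : mpd 0 f = f := by
  rw [mpd_eq_mpdL]
  induction List.finRange m with
  | nil => rfl
  | cons j L ih => rw [mpdL_cons, ih]; rfl

theorem mpd_congr (hU : IsOpen U) (α : Fin m → ℕ)
    {f g : EuclideanSpace ℝ (Fin m) → E}
    (h : EqOn f g U) : EqOn (mpd α f) (mpd α g) U := mpdL_congr hU _ α h

theorem mpd_smooth (hU : IsOpen U) (α : Fin m → ℕ)
    {f : EuclideanSpace ℝ (Fin m) → E}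
    (hf : ContDiffOn ℝ ∞ f U) : ContDiffOn ℝ ∞ (mpd α f) U := mpdL_smooth hU _ α hf

/-- commutation with continuous linear maps -/
theorem pd_clm (hU : IsOpen U) (T : E →L[ℝ] E') (i : Fin m) {f : EuclideanSpace ℝ (Fin m) → E}
    (hf : ContDiffOn ℝ ∞ f U) : EqOn (pd i (fun y => T (f y))) (fun y => T (pd i f y)) U := by
  intro x hx
  have := (T.hasFDerivAt.comp x (smooth_diffAt hU hf hx).hasFDerivAt).fderiv
  unfold pd
  change fderiv ℝ (T ∘ f) x _ = _
  rw [this]; rfl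

theorem pd_iter_clm (hU : IsOpen U) (T : E →L[ℝ] E') (i : Fin m) (k : ℕ)
    {f : EuclideanSpace ℝ (Fin m) → E} (hf : ContDiffOn ℝ ∞ f U) :
    EqOn ((pd i)^[k] (fun y => T (f y))) (fun y => T ((pd i)^[k] f y)) U := by
  induction k generalizing f with
  | zero => exact fun x _ => rfl
  | succ k ih =>
    exact (pd_iter_congr hU i k (pd_clm hU T i hf)).trans (ih (pd_smooth hU i hf))

theorem mpd_clm (hU : IsOpen U) (T : E →L[ℝ] E') (α : Fin m → ℕ)
    {f : EuclideanSpace ℝ (Fin m) → E} (hf : ContDiffOn ℝ ∞ f U) :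
    EqOn (mpd α (fun y => T (f y))) (fun y => T (mpd α f y)) U := by
  rw [mpd_eq_mpdL, mpd_eq_mpdL]
  induction List.finRange m with
  | nil => exact fun x _ => rfl
  | cons j L ih =>
    exact (pd_iter_congr hU j _ ih).trans (pd_iter_clm hU T j _ (mpdL_smooth hU L α hf))

theorem pd_sum (hU : IsOpen U) {ι : Type*} (s : Finset ι) (i : Fin m)
    {f : ι → EuclideanSpace ℝ (Fin m) → E}
    (hf : ∀ l, ContDiffOn ℝ ∞ (f l) U) :
    EqOn (pd i (fun y => ∑ l ∈ s, f l y)) (fun y => ∑ l ∈ s, pd i (f l) y) U := by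
  intro x hx
  unfold pd
  rw [fderiv_fun_sum (fun l _ => smooth_diffAt hU (hf l) hx)]
  simp

theorem pd_iter_sum (hU : IsOpen U) {ι : Type*} (s : Finset ι) (i : Fin m) (k : ℕ)
    {f : ι → EuclideanSpace ℝ (Fin m) → E}
    (hf : ∀ l, ContDiffOn ℝ ∞ (f l) U) :
    EqOn ((pd i)^[k] (fun y => ∑ l ∈ s, f l y)) (fun y => ∑ l ∈ s, (pd i)^[k] (f l) y) U := by
  induction k generalizing f with
  | zero => exact fun x _ => rfl
  | succ k ih =>
    exact (pd_iter_congr hU i k (pd_sum hU s i hf)).trans (ih (fun l => pd_smooth hU i (hf l)))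

theorem mpd_sum (hU : IsOpen U) {ι : Type*} (s : Finset ι) (α : Fin m → ℕ)
    {f : ι → EuclideanSpace ℝ (Fin m) → E}
    (hf : ∀ l, ContDiffOn ℝ ∞ (f l) U) :
    EqOn (mpd α (fun y => ∑ l ∈ s, f l y)) (fun y => ∑ l ∈ s, mpd α (f l) y) U := by
  simp only [mpd_eq_mpdL]
  induction List.finRange m with
  | nil => exact fun x _ => rfl
  | cons j L ih =>
    exact (pd_iter_congr hU j _ ih).trans
      (pd_iter_sum hU s j _ (fun l => mpdL_smooth hU L α (hf l)))

/-- joint smoothness in parameters -/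
theorem pd_joint {P : Type*} [NormedAddCommGroup P] [NormedSpace ℝ P] {Ω : Set P}
    (hU : IsOpen U) (i : Fin m) {F : P → EuclideanSpace ℝ (Fin m) → E}
    (hF : ContDiffOn ℝ ∞ (fun w : P × EuclideanSpace ℝ (Fin m) => F w.1 w.2) (Ω ×ˢ U)) :
    ContDiffOn ℝ ∞ (fun w : P × EuclideanSpace ℝ (Fin m) => pd i (F w.1) w.2) (Ω ×ˢ U) := by
  rw [contDiffOn_infty]
  intro n w hw
  have h1 : ContDiffWithinAt ℝ ((n : ℕ∞ω) + 1)
      (fun w : P × EuclideanSpace ℝ (Fin m) => F w.1 w.2) (Ω ×ˢ U) w :=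
    (hF w hw).of_le (by exact_mod_cast le_top)
  rw [contDiffWithinAt_succ_iff_hasFDerivWithinAt' (by simp)] at h1
  obtain ⟨u, hu, hus, -, f', hf', hc⟩ := h1
  rw [insert_eq_of_mem hw] at hu hus
  have key : ∀ x ∈ u, pd i (F x.1) x.2 = f' x (0, EuclideanSpace.single i 1) := by
    intro x hx
    have hxs := hus hx
    have hsl : HasFDerivWithinAt (fun ξ : EuclideanSpace ℝ (Fin m) => (x.1, ξ))
        (ContinuousLinearMap.inr ℝ P (EuclideanSpace ℝ (Fin m))) U x.2 :=
      (hasFDerivAt_prodMk_right x.1 x.2).hasFDerivWithinAt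
    have h2 := HasFDerivWithinAt.comp (x := x.2) (t := Ω ×ˢ U) (hf' x hx) hsl
      (fun ξ hξ => ⟨hxs.1, hξ⟩)
    have h3 := (h2.hasFDerivAt (hU.mem_nhds hxs.2)).fderiv
    unfold pd
    change fderiv ℝ ((fun w : P × EuclideanSpace ℝ (Fin m) => F w.1 w.2) ∘
      (fun ξ : EuclideanSpace ℝ (Fin m) => (x.1, ξ))) x.2 _ = _
    rw [h3]; simp
  have hc' : ContDiffWithinAt ℝ n (fun x => f' x (0, EuclideanSpace.single i 1)) (Ω ×ˢ U) w :=
    hc.clm_apply contDiffWithinAt_const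
  refine hc'.congr_of_eventuallyEq ?_ ?_
  · filter_upwards [hu] with x hx using key x hx
  · exact key w (mem_of_mem_nhdsWithin hw hu)

theorem mpd_joint {P : Type*} [NormedAddCommGroup P] [NormedSpace ℝ P] {Ω : Set P}
    (hU : IsOpen U) (α : Fin m → ℕ) {F : P → EuclideanSpace ℝ (Fin m) → E}
    (hF : ContDiffOn ℝ ∞ (fun w : P × EuclideanSpace ℝ (Fin m) => F w.1 w.2) (Ω ×ˢ U)) :
    ContDiffOn ℝ ∞ (fun w : P × EuclideanSpace ℝ (Fin m) => mpd α (F w.1) w.2) (Ω ×ˢ U) := by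
  simp only [mpd_eq_mpdL]
  induction List.finRange m with
  | nil => exact hF
  | cons j L ih =>
    simp only [mpdL_cons]
    have : ∀ (k : ℕ) (G : P → EuclideanSpace ℝ (Fin m) → E), 
      ContDiffOn ℝ ∞ (fun w : P × EuclideanSpace ℝ (Fin m) => G w.1 w.2) (Ω ×ˢ U) →
      ContDiffOn ℝ ∞ (fun w : P × EuclideanSpace ℝ (Fin m) => (pd j)^[k] (G w.1) w.2)
        (Ω ×ˢ U) := by
      intro k
      induction k with
      | zero => exact fun G h => h
      | succ k ihk => exact fun G h => ihk (fun p => pd j (G p)) (pd_joint hU j h)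
    exact this _ (fun p => mpdL L α (F p)) ih


theorem mpd_add (hU : IsOpen U) (α : Fin m → ℕ) {f g : EuclideanSpace ℝ (Fin m) → E}
    (hf : ContDiffOn ℝ ∞ f U) (hg : ContDiffOn ℝ ∞ g U) :
    EqOn (mpd α (fun y => f y + g y)) (fun y => mpd α f y + mpd α g y) U := by
  have := mpd_sum hU (Finset.univ : Finset (Fin 2)) α (f := ![f, g])
    (by intro l; fin_cases l <;> simpa)
  simpa [Fin.sum_univ_two] using this

/-- formal Taylor series -/
noncomputable def tay (f : EuclideanSpace ℝ (Fin m) → ℂ) (x : EuclideanSpace ℝ (Fin m)) :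
    MvPowerSeries (Fin m) ℂ :=
  fun α => mpd (⇑α) f x / ∏ i, ((α i).factorial : ℂ)

theorem coeff_tay (f : EuclideanSpace ℝ (Fin m) → ℂ) (x : EuclideanSpace ℝ (Fin m))
    (α : Fin m →₀ ℕ) :
    MvPowerSeries.coeff α (tay f x) = mpd (⇑α) f x / ∏ i, ((α i).factorial : ℂ) := rfl

theorem tay_congr (hU : IsOpen U) {f g : EuclideanSpace ℝ (Fin m) → ℂ}
    (h : EqOn f g U) {x} (hx : x ∈ U) : tay f x = tay g x := by
  ext α
  rw [coeff_tay, coeff_tay, mpd_congr hU _ h hx]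

theorem tay_add (hU : IsOpen U) {f g : EuclideanSpace ℝ (Fin m) → ℂ}
    (hf : ContDiffOn ℝ ∞ f U) (hg : ContDiffOn ℝ ∞ g U) {x} (hx : x ∈ U) :
    tay (fun y => f y + g y) x = tay f x + tay g x := by
  ext α
  rw [map_add, coeff_tay, coeff_tay, coeff_tay, mpd_add hU _ hf hg hx, add_div]

theorem prod_fact_succ (α : Fin m →₀ ℕ) (i : Fin m) :
    ∏ j, (((α + Finsupp.single i 1 : Fin m →₀ ℕ) j).factorial : ℂ) =
      ((α i : ℂ) + 1) * ∏ j, ((α j).factorial : ℂ) := by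
  classical
  rw [← Finset.mul_prod_erase _ _ (Finset.mem_univ i),
    ← Finset.mul_prod_erase _ (fun j => ((α j).factorial : ℂ)) (Finset.mem_univ i), ← mul_assoc]
  congr 1
  · simp [Nat.factorial_succ]
  · refine Finset.prod_congr rfl fun j hj => ?_
    have : j ≠ i := Finset.ne_of_mem_erase hj
    simp [this.symm]

theorem pderiv_tay (hU : IsOpen U) {f : EuclideanSpace ℝ (Fin m) → ℂ}
    (hf : ContDiffOn ℝ ∞ f U) {x} (hx : x ∈ U) (i : Fin m) :
    MvPowerSeries.pderiv ℂ i (tay f x) = tay (pd i f) x := by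
  ext α
  rw [MvPowerSeries.coeff_pderiv, coeff_tay, coeff_tay, prod_fact_succ, Finsupp.coe_add]
  have : (⇑(Finsupp.single i 1) : Fin m → ℕ) = Pi.single i 1 := by
    classical
    ext j; simp [Finsupp.single_apply, Pi.single_apply, eq_comm]
  rw [this, mpd_succ hU i _ hf hx]
  have h1 : (∏ j, ((α j).factorial : ℂ)) ≠ 0 :=
    Finset.prod_ne_zero_iff.2 fun j _ => by exact_mod_cast Nat.factorial_ne_zero _
  have h2 : ((α i : ℂ) + 1) ≠ 0 := Nat.cast_add_one_ne_zero _
  field_simp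

theorem pd_mul (hU : IsOpen U) (i : Fin m) {f g : EuclideanSpace ℝ (Fin m) → ℂ}
    (hf : ContDiffOn ℝ ∞ f U) (hg : ContDiffOn ℝ ∞ g U) :
    EqOn (pd i (fun y => f y * g y)) (fun y => pd i f y * g y + f y * pd i g y) U := by
  intro x hx
  unfold pd
  rw [fderiv_fun_mul (smooth_diffAt hU hf hx) (smooth_diffAt hU hg hx)]
  simp
  ring

theorem tay_mul (hU : IsOpen U) {f g : EuclideanSpace ℝ (Fin m) → ℂ}
    (hf : ContDiffOn ℝ ∞ f U) (hg : ContDiffOn ℝ ∞ g U) {x} (hx : x ∈ U) :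
    tay (fun y => f y * g y) x = tay f x * tay g x := by
  have key : ∀ (k : ℕ) (α : Fin m →₀ ℕ), α.degree = k → ∀ f g : EuclideanSpace ℝ (Fin m) → ℂ,
      ContDiffOn ℝ ∞ f U → ContDiffOn ℝ ∞ g U →
      MvPowerSeries.coeff α (tay (fun y => f y * g y) x) =
        MvPowerSeries.coeff α (tay f x * tay g x) := by
    intro k
    induction k with
    | zero =>
      intro α hα f g hf hg
      have : α = 0 := (Finsupp.degree_eq_zero_iff α).1 hα
      subst this
      rw [MvPowerSeries.coeff_mul]
      simp [coeff_tay, mpd_zero]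
    | succ k ih =>
      intro α hα f g hf hg
      have hne : α ≠ 0 := by rintro rfl; simp at hα
      obtain ⟨i, hi⟩ : ∃ i, α i ≠ 0 := by
        by_contra! h
        exact hne (Finsupp.ext h)
      obtain ⟨β, rfl⟩ : ∃ β, α = β + Finsupp.single i 1 := by
        refine ⟨α - Finsupp.single i 1, (tsub_add_cancel_of_le ?_).symm⟩
        rw [Finsupp.single_le_iff]; omega
      have hβ : β.degree = k := by
        rw [map_add, Finsupp.degree_single] at hα; omega
      have h2 : ((β i : ℂ) + 1) ≠ 0 := Nat.cast_add_one_ne_zero _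
      apply mul_right_cancel₀ h2
      rw [← MvPowerSeries.coeff_pderiv, ← MvPowerSeries.coeff_pderiv,
        pderiv_tay hU (hf.mul hg) hx, Derivation.leibniz, pderiv_tay hU hf hx,
        pderiv_tay hU hg hx, tay_congr hU (pd_mul hU i hf hg) hx,
        tay_add hU ((pd_smooth hU i hf).mul hg) (hf.mul (pd_smooth hU i hg)) hx,
        map_add, map_add, ih β hβ _ _ (pd_smooth hU i hf) hg, ih β hβ _ _ hf (pd_smooth hU i hg),
        smul_eq_mul, smul_eq_mul, add_comm, mul_comm (tay g x)]
  ext α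
  exact key _ α rfl f g hf hg

/-- embedding of bounded multi-indices -/
noncomputable def embK (m n : ℕ) : (Fin m → Fin (n + 1)) ↪ (Fin m →₀ ℕ) :=
    ⟨fun α => Finsupp.equivFunOnFinite.symm (fun i => (α i : ℕ)), by
      intro α β h
      have h := Finsupp.equivFunOnFinite.symm.injective h
      funext i
      exact Fin.ext (congrFun h i)⟩

theorem embK_coe (m n : ℕ) (α : Fin m → Fin (n + 1)) :
    (⇑(embK m n α) : Fin m → ℕ) = fun i => (α i : ℕ) := rfl

/-- multi-indices of degree at most `n` -/
noncomputable def KK (m n : ℕ) : Finset (Fin m →₀ ℕ) :=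
  (Finset.univ.filter (fun α : Fin m → Fin (n + 1) => ∑ i, (α i : ℕ) ≤ n)).map (embK m n)

theorem mem_KK {n : ℕ} {α : Fin m →₀ ℕ} : α ∈ KK m n ↔ α.degree ≤ n := by
  unfold KK
  simp only [Finset.mem_map, Finset.mem_filter, Finset.mem_univ, true_and]
  constructor
  · rintro ⟨β, hβ, rfl⟩
    simpa [Finsupp.degree_eq_sum, embK_coe] using hβ
  · intro h
    rw [Finsupp.degree_eq_sum] at h
    refine ⟨fun i => ⟨α i, ?_⟩, by simpa using h, ?_⟩
    · have := Finset.single_le_sum (f := fun i => α i) (fun _ _ => Nat.zero_le _)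
        (Finset.mem_univ i)
      exact Nat.lt_succ_of_le (this.trans h)
    · ext i; simp [embK_coe]

theorem cext_eq (n : ℕ) (f : EuclideanSpace ℝ (Fin m) → ℂ) (ξ η : EuclideanSpace ℝ (Fin m)) :
    cext n f ξ η = ∑ α ∈ KK m n, MvPowerSeries.coeff α (tay f ξ) *
      ∏ i, (Complex.I * (η i : ℂ)) ^ (α i) := by
  unfold cext KK
  rw [Finset.sum_map]
  refine Finset.sum_congr rfl fun α _ => ?_
  rw [coeff_tay]
  simp only [embK_coe, mul_pow,
    Finset.prod_mul_distrib, Finset.prod_pow_eq_pow_sum, smul_eq_mul]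
  ring

theorem norm_monomial_le {η : EuclideanSpace ℝ (Fin m)} (α : Fin m →₀ ℕ) :
    ‖∏ i, (Complex.I * (η i : ℂ)) ^ (α i)‖ ≤ ‖η‖ ^ α.degree := by
  rw [norm_prod, Finsupp.degree_eq_sum, ← Finset.prod_pow_eq_pow_sum]
  refine Finset.prod_le_prod (fun _ _ => norm_nonneg _) fun i _ => ?_
  rw [norm_pow]
  gcongr
  simpa using PiLp.norm_apply_le η i

theorem cext_mul_bound (hU : IsOpen U) {f g : EuclideanSpace ℝ (Fin m) → ℂ}
    (hf : ContDiffOn ℝ ∞ f U) (hg : ContDiffOn ℝ ∞ g U) {x} (hx : x ∈ U) (n : ℕ)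
    {η : EuclideanSpace ℝ (Fin m)} (hη : ‖η‖ ≤ 1) :
    ‖cext n f x η * cext n g x η - cext n (fun y => f y * g y) x η‖ ≤
      (∑ q ∈ KK m n ×ˢ KK m n, ‖MvPowerSeries.coeff q.1 (tay f x)‖ *
        ‖MvPowerSeries.coeff q.2 (tay g x)‖) * ‖η‖ ^ (n + 1) := by
  classical
  set X : (Fin m →₀ ℕ) → ℂ := fun α => ∏ i, (Complex.I * (η i : ℂ)) ^ (α i) with hX
  have hXadd : ∀ α β, X (α + β) = X α * X β := by
    intro α β; simp [hX, pow_add, Finset.prod_mul_distrib]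
  set G : (Fin m →₀ ℕ) × (Fin m →₀ ℕ) → ℂ := fun q => MvPowerSeries.coeff q.1 (tay f x) *
    MvPowerSeries.coeff q.2 (tay g x) * X (q.1 + q.2) with hG
  have h1 : cext n f x η * cext n g x η = ∑ q ∈ KK m n ×ˢ KK m n, G q := by
    rw [cext_eq, cext_eq, Finset.sum_mul_sum, Finset.sum_product]
    refine Finset.sum_congr rfl fun α _ => Finset.sum_congr rfl fun β _ => ?_
    simp only [hG, hXadd]
    change _ * X α * (_ * X β) = _
    ring
  have h2 : cext n (fun y => f y * g y) x η =
      ∑ q ∈ (KK m n ×ˢ KK m n).filter (fun q => (q.1 + q.2).degree ≤ n), G q := by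
    have hmaps : ∀ q ∈ (KK m n ×ˢ KK m n).filter (fun q => (q.1 + q.2).degree ≤ n),
        q.1 + q.2 ∈ KK m n := fun q hq => mem_KK.2 (Finset.mem_filter.1 hq).2
    rw [cext_eq, tay_mul hU hf hg hx, ← Finset.sum_fiberwise_of_maps_to hmaps G]
    refine Finset.sum_congr rfl fun γ hγ => ?_
    rw [MvPowerSeries.coeff_mul, Finset.sum_mul]
    have hγ' := mem_KK.1 hγ
    refine Finset.sum_congr ?_ ?_
    · ext q
      rw [Finset.HasAntidiagonal.mem_antidiagonal]
      simp only [Finset.mem_filter, Finset.mem_product, mem_KK]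
      constructor
      · rintro rfl
        rw [map_add] at hγ'
        refine ⟨⟨⟨?_, ?_⟩, by rwa [map_add]⟩, rfl⟩ <;> omega
      · exact fun h => h.2
    · intro q hq
      simp only [Finset.mem_filter] at hq
      simp only [hG, hq.2]
      rfl
  rw [h1, h2, ← Finset.sum_filter_add_sum_filter_not (KK m n ×ˢ KK m n)
    (fun q => (q.1 + q.2).degree ≤ n) G, add_sub_cancel_left, Finset.sum_mul]
  refine (norm_sum_le _ _).trans ?_
  have hsub := Finset.sum_le_sum_of_subset_of_nonneg
    (f := fun q : (Fin m →₀ ℕ) × (Fin m →₀ ℕ) => ‖MvPowerSeries.coeff q.1 (tay f x)‖ *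
        ‖MvPowerSeries.coeff q.2 (tay g x)‖ * ‖η‖ ^ (n + 1))
    (Finset.filter_subset (fun q => ¬ (q.1 + q.2).degree ≤ n) (KK m n ×ˢ KK m n))
      (fun q _ _ => mul_nonneg (mul_nonneg (norm_nonneg _) (norm_nonneg _))
        (pow_nonneg (norm_nonneg _) _))
  refine le_trans (Finset.sum_le_sum ?_) hsub
  intro q hq
  have hq' : n + 1 ≤ (q.1 + q.2).degree := by
    have := (Finset.mem_filter.1 hq).2
    omega
  simp only [hG, norm_mul]
  gcongr
  exact (norm_monomial_le _).trans (pow_le_pow_of_le_one (norm_nonneg _) hη hq')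


theorem cext_congr (hU : IsOpen U) {f g : EuclideanSpace ℝ (Fin m) → ℂ}
    (h : EqOn f g U) {x} (hx : x ∈ U) (n : ℕ) (η : EuclideanSpace ℝ (Fin m)) :
    cext n f x η = cext n g x η := by
  rw [cext_eq, cext_eq, tay_congr hU h hx]

theorem cext_sum (hU : IsOpen U) {ι : Type*} (s : Finset ι)
    {f : ι → EuclideanSpace ℝ (Fin m) → ℂ}
    (hf : ∀ l, ContDiffOn ℝ ∞ (f l) U) {x} (hx : x ∈ U) (n : ℕ)
    (η : EuclideanSpace ℝ (Fin m)) :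
    cext n (fun y => ∑ l ∈ s, f l y) x η = ∑ l ∈ s, cext n (f l) x η := by
  unfold cext
  rw [Finset.sum_comm]
  refine Finset.sum_congr rfl fun α _ => ?_
  rw [mpd_sum hU s _ hf hx, Finset.smul_sum]

theorem cext_mul_const (hU : IsOpen U) {f : EuclideanSpace ℝ (Fin m) → ℂ}
    (hf : ContDiffOn ℝ ∞ f U) {x} (hx : x ∈ U) (n : ℕ) (a : ℂ)
    (η : EuclideanSpace ℝ (Fin m)) :
    cext n (fun y => f y * a) x η = cext n f x η * a := by
  unfold cext
  rw [Finset.sum_mul]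
  refine Finset.sum_congr rfl fun α _ => ?_
  have := mpd_clm hU ((ContinuousLinearMap.mul ℝ ℂ).flip a) (fun i => (α i : ℕ)) hf hx
  simp only [ContinuousLinearMap.flip_apply, ContinuousLinearMap.mul_apply'] at this
  rw [this, smul_eq_mul, smul_eq_mul, mul_assoc]

theorem exists_succ {α : Fin m →₀ ℕ} (hne : α ≠ 0) : ∃ i β, α = β + Finsupp.single i 1 := by
  obtain ⟨i, hi⟩ : ∃ i, α i ≠ 0 := by
    by_contra! h
    exact hne (Finsupp.ext h)
  refine ⟨i, α - Finsupp.single i 1, (tsub_add_cancel_of_le ?_).symm⟩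
  rw [Finsupp.single_le_iff]; omega

theorem tay_zero (x : EuclideanSpace ℝ (Fin m)) : tay (fun _ => 0) x = 0 := by
  ext α
  have := mpd_sum (E := ℂ) isOpen_univ (∅ : Finset (Fin 0)) (⇑α) (m := m) (f := fun _ _ => 0)
    (fun _ => contDiffOn_const) (mem_univ x)
  simp only [Finset.sum_empty] at this
  rw [coeff_tay, this]; simp

theorem coeff_tay_const [DecidableEq (Fin m →₀ ℕ)] (c : ℂ) (x : EuclideanSpace ℝ (Fin m))
    (α : Fin m →₀ ℕ) :
    MvPowerSeries.coeff α (tay (fun _ => c) x) = if α = 0 then c else 0 := by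
  split_ifs with h
  · subst h; simp [coeff_tay, mpd_zero]
  · obtain ⟨i, β, rfl⟩ := exists_succ h
    have h2 : ((β i : ℂ) + 1) ≠ 0 := Nat.cast_add_one_ne_zero _
    apply mul_right_cancel₀ h2
    rw [← MvPowerSeries.coeff_pderiv, pderiv_tay isOpen_univ contDiffOn_const (mem_univ x)]
    have : pd i (fun _ : EuclideanSpace ℝ (Fin m) => c) = fun _ => 0 := by
      funext y; simp [pd]
    rw [this, tay_zero]; simp

theorem smooth_coord (j : Fin m) :
    ContDiff ℝ ∞ (fun y : EuclideanSpace ℝ (Fin m) => (y j : ℂ)) :=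
  Complex.ofRealCLM.contDiff.comp (EuclideanSpace.proj (𝕜 := ℝ) j).contDiff

theorem pd_coord (i j : Fin m) :
    pd i (fun y : EuclideanSpace ℝ (Fin m) => (y j : ℂ)) = fun _ => if i = j then 1 else 0 := by
  funext y
  unfold pd
  have h : HasFDerivAt (fun y : EuclideanSpace ℝ (Fin m) => (y j : ℂ))
      (Complex.ofRealCLM.comp (EuclideanSpace.proj (𝕜 := ℝ) j)) y :=
    (Complex.ofRealCLM.comp (EuclideanSpace.proj (𝕜 := ℝ) j)).hasFDerivAt
  rw [h.fderiv]
  by_cases hij : i = j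
  · subst hij; simp
  · simp [hij, Ne.symm hij]

theorem cext_const (n : ℕ) (c : ℂ) (x η : EuclideanSpace ℝ (Fin m)) :
    cext n (fun _ => c) x η = c := by
  classical
  rw [cext_eq]
  simp only [coeff_tay_const, ite_mul, zero_mul]
  rw [Finset.sum_ite_eq' (KK m n) 0, if_pos (mem_KK.2 (by simp))]
  simp

theorem coeff_tay_coord [DecidableEq (Fin m →₀ ℕ)] (j : Fin m) (x : EuclideanSpace ℝ (Fin m))
    (α : Fin m →₀ ℕ) :
    MvPowerSeries.coeff α (tay (fun y : EuclideanSpace ℝ (Fin m) => (y j : ℂ)) x) =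
      (if α = 0 then (x j : ℂ) else 0) + (if α = Finsupp.single j 1 then 1 else 0) := by
  by_cases h : α = 0
  · subst h
    have : (0 : Fin m →₀ ℕ) ≠ Finsupp.single j 1 := by
      intro h; simpa using congrArg Finsupp.degree h
    simp [coeff_tay, mpd_zero, this]
  · obtain ⟨i, β, rfl⟩ := exists_succ h
    rw [if_neg h, zero_add]
    have h2 : ((β i : ℂ) + 1) ≠ 0 := Nat.cast_add_one_ne_zero _
    apply mul_right_cancel₀ h2
    rw [← MvPowerSeries.coeff_pderiv,
      pderiv_tay isOpen_univ (smooth_coord j).contDiffOn (mem_univ x), pd_coord, coeff_tay_const]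
    by_cases hβ : β = 0
    · subst hβ
      by_cases hij : i = j
      · subst hij; simp
      · have : (Finsupp.single i 1 : Fin m →₀ ℕ) ≠ Finsupp.single j 1 := by
          intro h
          exact hij (Finsupp.single_left_injective one_ne_zero h)
        simp [hij, this]
    · have : β + Finsupp.single i 1 ≠ Finsupp.single j 1 := by
        intro h
        have h' := congrArg Finsupp.degree h
        rw [map_add, Finsupp.degree_single, Finsupp.degree_single] at h'
        exact hβ ((Finsupp.degree_eq_zero_iff β).1 (by omega))
      simp [hβ, this]

theorem cext_coord {n : ℕ} (hn : 1 ≤ n) (j : Fin m) (x η : EuclideanSpace ℝ (Fin m)) :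
    cext n (fun y : EuclideanSpace ℝ (Fin m) => (y j : ℂ)) x η =
      (x j : ℂ) + Complex.I * (η j : ℂ) := by
  classical
  rw [cext_eq]
  simp only [coeff_tay_coord, add_mul, ite_mul, zero_mul, Finset.sum_add_distrib]
  rw [Finset.sum_ite_eq' (KK m n) 0, if_pos (mem_KK.2 (by simp)),
    Finset.sum_ite_eq' (KK m n) (Finsupp.single j 1), if_pos (mem_KK.2 (by simpa using hn))]
  congr 1
  · simp
  · rw [one_mul, Finset.prod_eq_single j]
    · simp
    · intro b _ hb; simp [hb.symm]
    · simp

theorem cext_entry {N : ℕ} (hU : IsOpen U)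
    {F : EuclideanSpace ℝ (Fin m) → Matrix (Fin N) (Fin N) ℂ}
    (hF : ContDiffOn ℝ ∞ F U) {x} (hx : x ∈ U) (n : ℕ) (η : EuclideanSpace ℝ (Fin m))
    (a b : Fin N) :
    cext n F x η a b = cext n (fun y => F y a b) x η := by
  let T : Matrix (Fin N) (Fin N) ℂ →L[ℝ] ℂ :=
    LinearMap.toContinuousLinearMap
      { toFun := fun M => M a b, map_add' := fun _ _ => rfl, map_smul' := fun _ _ => rfl }
  have hT : ∀ M, T M = M a b := fun _ => rfl
  unfold cext
  rw [Matrix.sum_apply]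
  refine Finset.sum_congr rfl fun α _ => ?_
  rw [Matrix.smul_apply]
  congr 1
  exact (mpd_clm hU T (fun i => (α i : ℕ)) hF hx).symm

theorem cext_mul_uniform {P : Type*} [NormedAddCommGroup P] [NormedSpace ℝ P] {Ω : Set P}
    (hΩ : IsCompact Ω) (hU : IsOpen U) {F G : P → EuclideanSpace ℝ (Fin m) → ℂ}
    (hF : ContDiffOn ℝ ∞ (fun w : P × EuclideanSpace ℝ (Fin m) => F w.1 w.2) (Ω ×ˢ U))
    (hG : ContDiffOn ℝ ∞ (fun w : P × EuclideanSpace ℝ (Fin m) => G w.1 w.2) (Ω ×ˢ U))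
    {r : P → EuclideanSpace ℝ (Fin m)} (hr : ContinuousOn r Ω) (hrU : ∀ p ∈ Ω, r p ∈ U)
    (n : ℕ) :
    ∃ C : ℝ, ∀ p ∈ Ω, ∀ η : EuclideanSpace ℝ (Fin m), ‖η‖ ≤ 1 →
      ‖cext n (F p) (r p) η * cext n (G p) (r p) η - cext n (fun y => F p y * G p y) (r p) η‖ ≤
        C * ‖η‖ ^ (n + 1) := by
  have hc : ∀ {H : P → EuclideanSpace ℝ (Fin m) → ℂ},
      ContDiffOn ℝ ∞ (fun w : P × EuclideanSpace ℝ (Fin m) => H w.1 w.2) (Ω ×ˢ U) →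
      ∀ α : Fin m →₀ ℕ, ContinuousOn (fun p => MvPowerSeries.coeff α (tay (H p) (r p))) Ω := by
    intro H hH α
    simp only [coeff_tay]
    refine ContinuousOn.div_const ?_ _
    exact (mpd_joint hU (⇑α) hH).continuousOn.comp (continuousOn_id.prodMk hr)
      (fun p hp => ⟨hp, hrU p hp⟩)
  have hs : ∀ {H : P → EuclideanSpace ℝ (Fin m) → ℂ},
      ContDiffOn ℝ ∞ (fun w : P × EuclideanSpace ℝ (Fin m) => H w.1 w.2) (Ω ×ˢ U) →
      ∀ p ∈ Ω, ContDiffOn ℝ ∞ (H p) U := by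
    intro H hH p hp
    exact hH.comp (contDiff_prodMk_right p).contDiffOn (fun ξ hξ => ⟨hp, hξ⟩)
  obtain ⟨C, hC⟩ := hΩ.exists_bound_of_continuousOn
    (f := fun p => ∑ q ∈ KK m n ×ˢ KK m n, ‖MvPowerSeries.coeff q.1 (tay (F p) (r p))‖ *
        ‖MvPowerSeries.coeff q.2 (tay (G p) (r p))‖)
    (continuousOn_finsetSum _ fun q _ => (hc hF q.1).norm.mul (hc hG q.2).norm)
  refine ⟨C, fun p hp η hη => ?_⟩
  refine (cext_mul_bound hU (hs hF p hp) (hs hG p hp) (hrU p hp) n hη).trans ?_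
  gcongr
  exact (le_abs_self _).trans (hC p hp)

theorem continuous_dxRe {d : ℕ} {φ : ℝ × EuclideanSpace ℝ (Fin d) → ℂ}
    (hφ : ContDiff ℝ ∞ φ) : Continuous (dxRe φ) := by
  unfold dxRe
  refine (EuclideanSpace.equiv (Fin d) ℝ).symm.continuous.comp ?_
  refine continuous_pi fun i => ?_
  exact Complex.continuous_re.comp
    ((hφ.continuous_fderiv (by simp)).clm_apply continuous_const)


end helpers

/-- **Approximate spectral resolution of the principal symbol along a complex phase.**
With `A(t,x,ξ) = ∑_j A_j(t,x) ξ_j` Hermitian, `σ_{L₀}(t,x,τ,ξ) = i(τI + A(t,x,ξ))`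
(extended as a polynomial to complex `(τ,ξ)`), spectral data `λ_l, π_l` with
`∑_l π_l = I`, `π_l π_{l'} = δ_{ll'} π_l`, `A π_l = λ_l π_l`, and a complex phase
`φ = 𝜑 + iχ` with `χ ≥ 0` and `d_x𝜑 ≠ 0` on a compact `Ω̄`, for every `n ≥ 1` there is a
constant `C` such that wherever `|d_xχ| ≤ 1` on `Ω̄`:
`‖−iσ_{L₀}(t,x,∂_tφ,d_xφ) − ∑_l (∂_tφ + λ̃_l⁽ⁿ⁾(t,x,d_xφ)) π̃_l⁽ⁿ⁾(t,x,d_xφ)‖ ≤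
C |d_xχ|^{n+1}`. -/
theorem stmt_9 (d N mm : ℕ) (Ω : Set (ℝ × EuclideanSpace ℝ (Fin d))) (hΩ : IsCompact Ω)
    (Aj : Fin d → (ℝ × EuclideanSpace ℝ (Fin d)) → Matrix (Fin N) (Fin N) ℂ)
    (hAj : ∀ j, ContDiffOn ℝ (⊤ : ℕ∞) (Aj j) Ω)
    (hAjHerm : ∀ j, ∀ p ∈ Ω, (Aj j p).IsHermitian)
    (lam : Fin mm → (ℝ × EuclideanSpace ℝ (Fin d)) → EuclideanSpace ℝ (Fin d) → ℝ)
    (π : Fin mm → (ℝ × EuclideanSpace ℝ (Fin d)) → EuclideanSpace ℝ (Fin d) →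
      Matrix (Fin N) (Fin N) ℂ)
    (hlam : ∀ l, ContDiffOn ℝ (⊤ : ℕ∞)
      (fun w : (ℝ × EuclideanSpace ℝ (Fin d)) × EuclideanSpace ℝ (Fin d) => lam l w.1 w.2)
      (Ω ×ˢ {ξ : EuclideanSpace ℝ (Fin d) | ξ ≠ 0}))
    (hπ : ∀ l, ContDiffOn ℝ (⊤ : ℕ∞)
      (fun w : (ℝ × EuclideanSpace ℝ (Fin d)) × EuclideanSpace ℝ (Fin d) => π l w.1 w.2)
      (Ω ×ˢ {ξ : EuclideanSpace ℝ (Fin d) | ξ ≠ 0}))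
    (hsum : ∀ p ∈ Ω, ∀ ξ : EuclideanSpace ℝ (Fin d), ξ ≠ 0 → ∑ l, π l p ξ = 1)
    (horth : ∀ l l', ∀ p ∈ Ω, ∀ ξ : EuclideanSpace ℝ (Fin d), ξ ≠ 0 →
      π l p ξ * π l' p ξ = if l = l' then π l p ξ else 0)
    (heig : ∀ l, ∀ p ∈ Ω, ∀ ξ : EuclideanSpace ℝ (Fin d), ξ ≠ 0 →
      (∑ j, (ξ j : ℂ) • Aj j p) * π l p ξ = (lam l p ξ : ℂ) • π l p ξ)
    (φ : ℝ × EuclideanSpace ℝ (Fin d) → ℂ) (hφ : ContDiff ℝ (⊤ : ℕ∞) φ)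
    (hχpos : ∀ p ∈ Ω, 0 ≤ (φ p).im)
    (hgrad : ∀ p ∈ Ω, dxRe φ p ≠ 0) :
    ∀ n : ℕ, 1 ≤ n → ∃ C : ℝ, ∀ p ∈ Ω, ‖dxIm φ p‖ ≤ 1 →
      ‖-(Complex.I •
            (Complex.I • ((dtP φ p) • (1 : Matrix (Fin N) (Fin N) ℂ) +
              ∑ j, ((dxRe φ p j : ℂ) + Complex.I * (dxIm φ p j : ℂ)) • Aj j p))) -
          ∑ l, (dtP φ p + cext n (fun ζ => (lam l p ζ : ℂ)) (dxRe φ p) (dxIm φ p)) •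
            cext n (π l p) (dxRe φ p) (dxIm φ p)‖ ≤
        C * ‖dxIm φ p‖ ^ (n + 1) := by
  intro n hn
  set U : Set (EuclideanSpace ℝ (Fin d)) := {ξ | ξ ≠ 0} with hUdef
  have hU : IsOpen U := isOpen_ne
  have hl : ∀ l, ContDiffOn ℝ (⊤ : ℕ∞)
      (fun w : (ℝ × EuclideanSpace ℝ (Fin d)) × EuclideanSpace ℝ (Fin d) =>
        (lam l w.1 w.2 : ℂ)) (Ω ×ˢ U) := fun l =>
    Complex.ofRealCLM.contDiff.comp_contDiffOn (hlam l)
  have hp : ∀ l a b, ContDiffOn ℝ (⊤ : ℕ∞)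
      (fun w : (ℝ × EuclideanSpace ℝ (Fin d)) × EuclideanSpace ℝ (Fin d) =>
        π l w.1 w.2 a b) (Ω ×ˢ U) := fun l a b =>
    contDiffOn_pi.1 (contDiffOn_pi.1 (hπ l) a) b
  have slice : ∀ {V : Type} [NormedAddCommGroup V] [NormedSpace ℝ V]
      {H : (ℝ × EuclideanSpace ℝ (Fin d)) → EuclideanSpace ℝ (Fin d) → V},
      ContDiffOn ℝ (⊤ : ℕ∞) (fun w : (ℝ × EuclideanSpace ℝ (Fin d)) × EuclideanSpace ℝ (Fin d) =>
        H w.1 w.2) (Ω ×ˢ U) → ∀ p ∈ Ω, ContDiffOn ℝ (⊤ : ℕ∞) (H p) U := by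
    intro V _ _ H hH p hp
    exact hH.comp (contDiff_prodMk_right p).contDiffOn (fun ξ hξ => ⟨hp, hξ⟩)
  have hr := (continuous_dxRe hφ).continuousOn (s := Ω)
  choose C hC using fun l a b => cext_mul_uniform (F := fun p y => (lam l p y : ℂ))
    (G := fun p y => π l p y a b) hΩ hU (hl l) (hp l a b) hr hgrad n
  refine ⟨∑ a, ∑ b, ∑ l, |C l a b|, fun p hpΩ hη => ?_⟩
  have hx : dxRe φ p ∈ U := hgrad p hpΩ
  rw [Matrix.norm_le_iff (by positivity)]
  intro a b
  -- the three algebraic identities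
  have e1 : ∑ l, cext n (fun y => π l p y a b) (dxRe φ p) (dxIm φ p) =
      (1 : Matrix (Fin N) (Fin N) ℂ) a b := by
    rw [← cext_sum hU _ (fun l => slice (H := fun p y => π l p y a b) (hp l a b) p hpΩ) hx,
      ← cext_const n ((1 : Matrix (Fin N) (Fin N) ℂ) a b) (dxRe φ p) (dxIm φ p)]
    refine cext_congr hU (fun ξ hξ => ?_) hx n _
    rw [← hsum p hpΩ ξ hξ, Matrix.sum_apply]
  have e2 : ∑ l, cext n (fun y => (lam l p y : ℂ) * π l p y a b) (dxRe φ p) (dxIm φ p) =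
      ∑ j, ((dxRe φ p j : ℂ) + Complex.I * (dxIm φ p j : ℂ)) * Aj j p a b := by
    rw [← cext_sum hU _ (fun l => (slice (H := fun p y => (lam l p y : ℂ)) (hl l) p hpΩ).mul (slice (H := fun p y => π l p y a b) (hp l a b) p hpΩ)) hx]
    have h3 : ∀ j, ((dxRe φ p j : ℂ) + Complex.I * (dxIm φ p j : ℂ)) * Aj j p a b =
        cext n (fun y : EuclideanSpace ℝ (Fin d) => (y j : ℂ) * Aj j p a b)
          (dxRe φ p) (dxIm φ p) := by
      intro j
      rw [cext_mul_const hU (smooth_coord j).contDiffOn hx, cext_coord hn]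
    simp only [h3]
    rw [← cext_sum hU _ (fun j => (smooth_coord j).contDiffOn.mul contDiffOn_const) hx]
    refine cext_congr hU (fun ξ hξ => ?_) hx n _
    have h4 : (∑ j, (ξ j : ℂ) • Aj j p) = ∑ l, (lam l p ξ : ℂ) • π l p ξ := by
      rw [← Finset.sum_congr rfl (fun l _ => heig l p hpΩ ξ hξ), ← Finset.mul_sum,
        hsum p hpΩ ξ hξ, mul_one]
    have h5 := congrFun (congrFun h4 a) b
    simp only [Matrix.sum_apply, Matrix.smul_apply, smul_eq_mul] at h5
    exact h5.symm
  have e3 : ∀ l, cext n (π l p) (dxRe φ p) (dxIm φ p) a b =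
      cext n (fun y => π l p y a b) (dxRe φ p) (dxIm φ p) := fun l =>
    cext_entry hU (slice (H := π l) (hπ l) p hpΩ) hx n _ a b
  have e4 : (-(Complex.I •
            (Complex.I • ((dtP φ p) • (1 : Matrix (Fin N) (Fin N) ℂ) +
              ∑ j, ((dxRe φ p j : ℂ) + Complex.I * (dxIm φ p j : ℂ)) • Aj j p))) -
          ∑ l, (dtP φ p + cext n (fun ζ => (lam l p ζ : ℂ)) (dxRe φ p) (dxIm φ p)) •
            cext n (π l p) (dxRe φ p) (dxIm φ p)) a b =
      -∑ l, (cext n (fun ζ => (lam l p ζ : ℂ)) (dxRe φ p) (dxIm φ p) *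
        cext n (fun y => π l p y a b) (dxRe φ p) (dxIm φ p) -
        cext n (fun y => (lam l p y : ℂ) * π l p y a b) (dxRe φ p) (dxIm φ p)) := by
    rw [smul_smul, Complex.I_mul_I, neg_smul, one_smul, neg_neg]
    simp only [Matrix.sub_apply, Matrix.add_apply, Matrix.smul_apply, Matrix.sum_apply,
      smul_eq_mul, e3, add_mul, Finset.sum_add_distrib, Finset.sum_sub_distrib, ← Finset.mul_sum,
      e1, e2]
    ring
  rw [e4, norm_neg]
  refine (norm_sum_le _ _).trans ?_
  refine (Finset.sum_le_sum fun l _ =>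
    (hC l a b p hpΩ (dxIm φ p) hη).trans
      (mul_le_mul_of_nonneg_right (le_abs_self _) (by positivity))).trans ?_
  rw [← Finset.sum_mul]
  refine mul_le_mul_of_nonneg_right ?_ (by positivity)
  refine (Finset.single_le_sum (f := fun b => ∑ l, |C l a b|) (fun _ _ => by positivity)
    (Finset.mem_univ b)).trans ?_
  exact Finset.single_le_sum (f := fun a => ∑ b, ∑ l, |C l a b|) (fun _ _ => by positivity)
    (Finset.mem_univ a)
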